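/- arXiv:2210.00027 — 3 statements merged into one kernel-verified Lean document; each statement's English description precedes it below -/
import Mathlib

section
/- For every p ∈ (1, ∞), the operator norm of the Kak–Hilbert transform 𝓚 on ℓ^p(ℤ) equals the operator norm of the Riesz–Titchmarsh operator 𝓡 on ℓ^p(ℤ). -/
open scoped BigOperators
open MeasureTheory

noncomputable section

/-- The ℓ^p norm of a doubly infinite complex sequence. -/
def lpNorm (p : ℝ) (a : ℤ → ℂ) : ℝ := (∑' n : ℤ, ‖a n‖ ^ p) ^ (1 / p)

/-- Membership in ℓ^p(ℤ). -/
def MemLpZ (p : ℝ) (a : ℤ → ℂ) : Prop := Summable fun n : ℤ => ‖a n‖ ^ p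

/-- The operator norm of an operator on ℓ^p(ℤ): the least admissible constant. -/
def opNormOn (p : ℝ) (T : (ℤ → ℂ) → ℤ → ℂ) : ℝ :=
  sInf {C : ℝ | 0 ≤ C ∧ ∀ a : ℤ → ℂ, MemLpZ p a → lpNorm p (T a) ≤ C * lpNorm p a}

/-- The Riesz–Titchmarsh operator: 𝓡 a_n = (1/π) Σ_{m ∈ ℤ} a_{n-m}/(m + 1/2). -/
def RT (a : ℤ → ℂ) (n : ℤ) : ℂ :=
  (1 / (Real.pi : ℂ)) * ∑' m : ℤ, a (n - m) / ((m : ℂ) + 1 / 2)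

/-- The Kak–Hilbert transform: 𝓚 a_n = (2/π) Σ_{m odd} a_{n-m}/m. -/
def KT (a : ℤ → ℂ) (n : ℤ) : ℂ :=
  (2 / (Real.pi : ℂ)) * ∑' m : {m : ℤ // Odd m}, a (n - (m : ℤ)) / ((m : ℤ) : ℂ)

/-- The discrete Hilbert transform: 𝓗₀ a_n = (1/π) Σ_{m ≠ 0} a_{n-m}/m. -/
def H0T (a : ℤ → ℂ) (n : ℤ) : ℂ :=
  (1 / (Real.pi : ℂ)) * ∑' m : {m : ℤ // m ≠ 0}, a (n - (m : ℤ)) / ((m : ℤ) : ℂ)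

/-- The operator 𝓗: 𝓗 a_n = (2/π) Σ_{m even, m ≠ 0} a_{n-m}/m. -/
def HT (a : ℤ → ℂ) (n : ℤ) : ℂ :=
  (2 / (Real.pi : ℂ)) *
    ∑' m : {m : ℤ // Even (m : ℤ) ∧ (m : ℤ) ≠ 0}, a (n - (m : ℤ)) / ((m : ℤ) : ℂ)

/-- The operator 𝓘: 𝓘 a_n = (4/π²) Σ_{m odd} a_{n-m}/m². -/
def IT (a : ℤ → ℂ) (n : ℤ) : ℂ :=
  (4 / (Real.pi : ℂ) ^ 2) * ∑' m : {m : ℤ // Odd m}, a (n - (m : ℤ)) / ((m : ℤ) : ℂ) ^ 2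

/-- p* = max(p, p/(p-1)). -/
def pstar (p : ℝ) : ℝ := max p (p / (p - 1))

/-- C_p = cot(π/(2 p*)). -/
def Cconst (p : ℝ) : ℝ := Real.cot (Real.pi / (2 * pstar p))


/-- A function on `ℤ` is summable as soon as its restrictions to the even and the odd integers
are, and its sum is the sum of the two. -/
theorem HasSum.int_even_add_odd {f : ℤ → ℝ} {s t : ℝ}
    (hs : HasSum (fun k => f (2 * k)) s) (ht : HasSum (fun k => f (2 * k + 1)) t) :
    HasSum f (s + t) := by
  have hinj : Function.Injective (fun k : ℤ => 2 * k) := fun x y h => by simpa using h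
  have hinj' : Function.Injective (fun k : ℤ => 2 * k + 1) := fun x y h => by simpa using h
  refine (hinj.hasSum_range_iff.2 hs).add_isCompl ?_ (hinj'.hasSum_range_iff.2 ht)
  refine ⟨Set.disjoint_iff_forall_ne.2 ?_, codisjoint_iff.2 (Set.eq_univ_of_forall fun n => ?_)⟩
  · rintro _ ⟨a, rfl⟩ _ ⟨b, rfl⟩
    dsimp only
    omega
  · rcases Int.even_or_odd' n with ⟨k, h | h⟩
    · exact Or.inl ⟨k, h.symm⟩
    · exact Or.inr ⟨k, h.symm⟩

theorem Summable.tsum_int_even_add_odd {f : ℤ → ℝ} (hf : Summable f) :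
    ∑' n, f n = ∑' k, f (2 * k) + ∑' k, f (2 * k + 1) :=
  (HasSum.int_even_add_odd
    (hf.comp_injective (i := fun k : ℤ => 2 * k) fun x y h => by simpa using h).hasSum
    (hf.comp_injective (i := fun k : ℤ => 2 * k + 1) fun x y h => by simpa using h).hasSum).tsum_eq

theorem tsum_odd_eq_tsum_int (f : ℤ → ℂ) :
    ∑' m : {m : ℤ // Odd m}, f m = ∑' k : ℤ, f (2 * k + 1) := by
  let e : ℤ ≃ {m : ℤ // Odd m} := Equiv.ofBijective (fun k => ⟨2 * k + 1, k, rfl⟩)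
    ⟨fun x y h => by simpa using congrArg Subtype.val h, fun ⟨m, k, hk⟩ => ⟨k, Subtype.ext hk.symm⟩⟩
  exact (e.tsum_eq fun m : {m : ℤ // Odd m} => f m).symm

theorem KT_eq_tsum (a : ℤ → ℂ) (n : ℤ) :
    KT a n = (1 / (Real.pi : ℂ)) * ∑' k : ℤ, a (n - (2 * k + 1)) / ((k : ℂ) + 1 / 2) := by
  rw [KT, tsum_odd_eq_tsum_int fun m => a (n - m) / (m : ℂ), ← tsum_mul_left, ← tsum_mul_left]
  refine tsum_congr fun k => ?_
  have h : ((2 * k + 1 : ℤ) : ℂ) = 2 * ((k : ℂ) + 1 / 2) := by push_cast; ring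
  rw [h, div_mul_div_comm, div_mul_div_comm, mul_left_comm,
    mul_div_mul_left _ _ two_ne_zero, one_mul]

theorem KT_even (a : ℤ → ℂ) (j : ℤ) :
    KT a (2 * j) = RT (fun i => a (2 * i - 1)) j := by
  rw [KT_eq_tsum, RT]
  simp only [show ∀ k : ℤ, 2 * j - (2 * k + 1) = 2 * (j - k) - 1 from fun k => by ring]

theorem KT_odd (a : ℤ → ℂ) (j : ℤ) :
    KT a (2 * j + 1) = RT (fun i => a (2 * i)) j := by
  rw [KT_eq_tsum, RT]
  simp only [show ∀ k : ℤ, 2 * j + 1 - (2 * k + 1) = 2 * (j - k) from fun k => by ring]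

theorem lpNorm_le_mul_lpNorm_iff {p : ℝ} (hp : 0 < p) {C : ℝ} (hC : 0 ≤ C) (a b : ℤ → ℂ) :
    lpNorm p b ≤ C * lpNorm p a ↔ ∑' n, ‖b n‖ ^ p ≤ C ^ p * ∑' n, ‖a n‖ ^ p := by
  have ha : 0 ≤ ∑' n, ‖a n‖ ^ p := tsum_nonneg fun n => by positivity
  have hb : 0 ≤ ∑' n, ‖b n‖ ^ p := tsum_nonneg fun n => by positivity
  unfold _root_.lpNorm
  rw [one_div, ← Real.rpow_le_rpow_iff (by positivity) (by positivity) hp,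
    Real.mul_rpow hC (by positivity), Real.rpow_inv_rpow hb hp.ne', Real.rpow_inv_rpow ha hp.ne']

theorem KT_bound_of_RT_bound {p : ℝ} (hp : 0 < p) {C : ℝ} (hC : 0 ≤ C)
    (h : ∀ a : ℤ → ℂ, MemLpZ p a → lpNorm p (RT a) ≤ C * lpNorm p a)
    (a : ℤ → ℂ) (ha : MemLpZ p a) : lpNorm p (KT a) ≤ C * lpNorm p a := by
  rw [lpNorm_le_mul_lpNorm_iff hp hC]
  by_cases hK : Summable fun n => ‖KT a n‖ ^ p
  · have he : MemLpZ p fun i => a (2 * i) :=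
      ha.comp_injective (i := fun k : ℤ => 2 * k) fun x y h => by simpa using h
    have ho : MemLpZ p fun i => a (2 * i - 1) :=
      ha.comp_injective (i := fun k : ℤ => 2 * k - 1) fun x y h => by simpa using h
    have hshift : ∑' k : ℤ, ‖a (2 * k + 1)‖ ^ p = ∑' k : ℤ, ‖a (2 * k - 1)‖ ^ p := by
      rw [← (Equiv.addRight (1 : ℤ)).tsum_eq fun k : ℤ => ‖a (2 * k - 1)‖ ^ p]
      refine tsum_congr fun k => ?_
      rw [Equiv.coe_addRight, show 2 * (k + 1) - 1 = 2 * k + 1 by ring]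
    rw [hK.tsum_int_even_add_odd, Summable.tsum_int_even_add_odd ha, hshift]
    simp only [KT_even, KT_odd]
    have h1 := (lpNorm_le_mul_lpNorm_iff hp hC _ _).1 (h _ he)
    have h2 := (lpNorm_le_mul_lpNorm_iff hp hC _ _).1 (h _ ho)
    linarith
  · rw [tsum_eq_zero_of_not_summable hK]
    exact mul_nonneg (by positivity) (tsum_nonneg fun n => by positivity)

theorem RT_bound_of_KT_bound {p : ℝ} (hp : 0 < p) {C : ℝ} (hC : 0 ≤ C)
    (h : ∀ a : ℤ → ℂ, MemLpZ p a → lpNorm p (KT a) ≤ C * lpNorm p a)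
    (b : ℤ → ℂ) (hb : MemLpZ p b) : lpNorm p (RT b) ≤ C * lpNorm p b := by
  let a : ℤ → ℂ := fun n => if Even n then b (n / 2) else 0
  have hae (k : ℤ) : a (2 * k) = b k := by simp [a]
  have hao (k : ℤ) : a (2 * k + 1) = 0 := by simp [a]
  have hao' (k : ℤ) : a (2 * k - 1) = 0 := by simp [a]
  have hsum : HasSum (fun n => ‖a n‖ ^ p) (∑' n, ‖b n‖ ^ p) := by
    have hs : HasSum (fun k => ‖a (2 * k)‖ ^ p) (∑' n, ‖b n‖ ^ p) := by
      simpa only [hae] using hb.hasSum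
    have ht : HasSum (fun k => ‖a (2 * k + 1)‖ ^ p) 0 := by
      simpa only [hao, norm_zero, Real.zero_rpow hp.ne'] using hasSum_zero
    simpa using HasSum.int_even_add_odd (f := fun n => ‖a n‖ ^ p) hs ht
  have hKe (j : ℤ) : KT a (2 * j) = 0 := by
    rw [KT_even]
    simp [RT, hao']
  have hKo (j : ℤ) : KT a (2 * j + 1) = RT b j := by
    rw [KT_odd]
    simp only [hae]
  have hK : ∑' n, ‖KT a n‖ ^ p = ∑' n, ‖RT b n‖ ^ p := by
    have hinj : Function.Injective (fun k : ℤ => 2 * k + 1) := fun x y h => by simpa using h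
    rw [← hinj.tsum_eq (f := fun n => ‖KT a n‖ ^ p)]
    · simp only [hKo]
    · intro n hn
      rcases Int.even_or_odd' n with ⟨k, rfl | rfl⟩
      · simp [hKe, hp.ne'] at hn
      · exact ⟨k, rfl⟩
  have := (lpNorm_le_mul_lpNorm_iff hp hC _ _).1 (h a hsum.summable)
  rw [hK, hsum.tsum_eq] at this
  exact (lpNorm_le_mul_lpNorm_iff hp hC _ _).2 this

/-- The operator norms of the Kak–Hilbert transform and of the Riesz–Titchmarsh
operator on ℓ^p(ℤ) coincide. -/
theorem kak_norm_eq_riesz_titchmarsh_norm (p : ℝ) (hp : 1 < p) :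
    opNormOn p KT = opNormOn p RT := by
  have hp0 : 0 < p := one_pos.trans hp
  unfold opNormOn
  congr 1
  ext C
  exact and_congr_right fun hC => ⟨RT_bound_of_KT_bound hp0 hC, KT_bound_of_RT_bound hp0 hC⟩

end
end

section
/- For every p ∈ (1, ∞), the operator norm of the operator 𝓗 on ℓ^p(ℤ) equals the operator norm of the discrete Hilbert transform 𝓗₀ on ℓ^p(ℤ). -/
open scoped BigOperators
open MeasureTheory

noncomputable section

/-- An `ℓ^p` norm inequality, raised to the power `p`. -/
theorem lpNorm_le_mul_iff {p C : ℝ} (hp : 0 < p) (hC : 0 ≤ C) (a b : ℤ → ℂ) :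
    lpNorm p a ≤ C * lpNorm p b ↔ ∑' n, ‖a n‖ ^ p ≤ C ^ p * ∑' n, ‖b n‖ ^ p := by
  have ha : 0 ≤ ∑' n, ‖a n‖ ^ p := tsum_nonneg fun n => by positivity
  have hb : 0 ≤ ∑' n, ‖b n‖ ^ p := tsum_nonneg fun n => by positivity
  have h : C * lpNorm p b = (C ^ p * ∑' n, ‖b n‖ ^ p) ^ (1 / p) := by
    rw [Real.mul_rpow (by positivity) hb, ← Real.rpow_mul hC, mul_one_div_cancel hp.ne',
      Real.rpow_one, _root_.lpNorm]
  rw [h, _root_.lpNorm, Real.rpow_le_rpow_iff ha (by positivity) (by positivity)]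

theorem injective_two_mul_add (r : ℤ) : Function.Injective fun k : ℤ => 2 * k + r :=
  fun x y h => by simp only at h; omega

theorem hasSum_int_even_add_odd {f : ℤ → ℝ} {s t : ℝ} (hs : HasSum (fun k => f (2 * k + 0)) s)
    (ht : HasSum (fun k => f (2 * k + 1)) t) : HasSum f (s + t) := by
  have h : IsCompl (Set.range fun k : ℤ => 2 * k + 0) (Set.range fun k : ℤ => 2 * k + 1) := by
    rw [isCompl_iff, codisjoint_iff, Set.disjoint_left]
    refine ⟨?_, ?_⟩
    · rintro _ ⟨k, rfl⟩ ⟨l, hl⟩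
      simp only at hl
      omega
    · refine Set.eq_univ_of_forall fun n => ?_
      obtain ⟨k, hk | hk⟩ := Int.even_or_odd' n
      · exact Or.inl ⟨k, by simp only; omega⟩
      · exact Or.inr ⟨k, hk.symm⟩
  exact HasSum.add_isCompl h ((injective_two_mul_add 0).hasSum_range_iff.2 hs)
    ((injective_two_mul_add 1).hasSum_range_iff.2 ht)

/-- Doubling identifies the nonzero integers with the nonzero even integers. -/
def doubleEquiv : {m : ℤ // m ≠ 0} ≃ {m : ℤ // Even m ∧ m ≠ 0} where
  toFun m := ⟨2 * m, even_two_mul _, mul_ne_zero two_ne_zero m.2⟩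
  invFun m := ⟨m / 2, by obtain ⟨_, ⟨k, rfl⟩, h⟩ := m; simp only; omega⟩
  left_inv m := by ext; simp
  right_inv m := by ext; exact Int.two_mul_ediv_two_of_even m.2.1

/-- On each residue class modulo `2`, the operator `HT` is a copy of `H0T`. -/
theorem HT_two_mul_add (a : ℤ → ℂ) (r k : ℤ) :
    HT a (2 * k + r) = H0T (fun j => a (2 * j + r)) k := by
  rw [HT, H0T, ← doubleEquiv.tsum_eq, ← tsum_mul_left, ← tsum_mul_left]
  refine tsum_congr fun m => ?_
  have hm : ((m : ℤ) : ℂ) ≠ 0 := Int.cast_ne_zero.2 m.2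
  have hπ : (Real.pi : ℂ) ≠ 0 := Complex.ofReal_ne_zero.2 Real.pi_ne_zero
  have hi : 2 * k + r - 2 * (m : ℤ) = 2 * (k - m) + r := by ring
  simp only [doubleEquiv, Equiv.coe_fn_mk, hi]
  push_cast
  field_simp

theorem H0T_zero : H0T (fun _ => 0) = fun _ => 0 := by
  ext n
  simp [H0T]

/-- The sequence supported on the even integers with `a (2 * k) = b k`. -/
def evenExtend (b : ℤ → ℂ) (n : ℤ) : ℂ := if Even n then b (n / 2) else 0

theorem evenExtend_even (b : ℤ → ℂ) (k : ℤ) : evenExtend b (2 * k + 0) = b k := by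
  simp [evenExtend]

theorem evenExtend_odd (b : ℤ → ℂ) (k : ℤ) : evenExtend b (2 * k + 1) = 0 := by
  simp [evenExtend]

/-- A sequence vanishing at odd integers has the same `p`-th power sum as its even part. -/
theorem tsum_of_odd_eq_zero {p : ℝ} (hp : 0 < p) {a b : ℤ → ℂ} (h₀ : ∀ k, a (2 * k + 0) = b k)
    (h₁ : ∀ k, a (2 * k + 1) = 0) :
    (MemLpZ p b → MemLpZ p a) ∧ ∑' n, ‖a n‖ ^ p = ∑' n, ‖b n‖ ^ p := by
  have hsupp : Function.support (fun n => ‖a n‖ ^ p) ⊆ Set.range fun k : ℤ => 2 * k + 0 := by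
    intro n hn
    obtain ⟨k, hk | hk⟩ := Int.even_or_odd' n
    · exact ⟨k, by simp only; omega⟩
    · simp [hk, h₁, Real.zero_rpow hp.ne'] at hn
  constructor
  · intro hb
    refine ((injective_two_mul_add 0).summable_iff fun n hn => ?_).1 ?_
    · exact Function.notMem_support.1 fun h => hn (hsupp h)
    · simpa only [Function.comp_def, h₀, MemLpZ] using hb
  · rw [← (injective_two_mul_add 0).tsum_eq hsupp]
    simp only [h₀]

/-- The operator norms of 𝓗 and of the discrete Hilbert transform 𝓗₀ on ℓ^p(ℤ)
coincide. -/
theorem H_norm_eq_H0_norm (p : ℝ) (hp : 1 < p) :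
    opNormOn p HT = opNormOn p H0T := by
  have hp₀ : 0 < p := by linarith
  unfold opNormOn
  congr 1
  ext C
  refine and_congr_right fun hC => ⟨fun h b hb => ?_, fun h a ha => ?_⟩
  · obtain ⟨hmem, hsum⟩ := tsum_of_odd_eq_zero hp₀ (evenExtend_even b) (evenExtend_odd b)
    have hT := (tsum_of_odd_eq_zero hp₀ (a := HT (evenExtend b)) (b := H0T b)
      (fun k => by rw [HT_two_mul_add]; simp only [evenExtend_even])
      (fun k => by rw [HT_two_mul_add]; simp only [evenExtend_odd, H0T_zero])).2
    have := h _ (hmem hb)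
    rwa [lpNorm_le_mul_iff hp₀ hC, hT, hsum, ← lpNorm_le_mul_iff hp₀ hC] at this
  · rw [lpNorm_le_mul_iff hp₀ hC]
    by_cases hs : Summable fun n => ‖HT a n‖ ^ p
    · have hsplit {f : ℤ → ℝ} (hf : Summable f) :
          ∑' n, f n = ∑' k, f (2 * k + 0) + ∑' k, f (2 * k + 1) :=
        (hasSum_int_even_add_odd (hf.comp_injective (injective_two_mul_add 0)).hasSum
          (hf.comp_injective (injective_two_mul_add 1)).hasSum).tsum_eq
      have hr (r : ℤ) := (lpNorm_le_mul_iff hp₀ hC _ _).1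
        (h (fun k => a (2 * k + r)) (ha.comp_injective (injective_two_mul_add r)))
      rw [hsplit hs, hsplit ha, mul_add]
      simp only [HT_two_mul_add]
      exact add_le_add (hr 0) (hr 1)
    · rw [tsum_eq_zero_of_not_summable hs]
      exact mul_nonneg (by positivity) (tsum_nonneg fun n => by positivity)

end
end

section
/- For every p ∈ (1, ∞), the operator norm of the operator 𝓘 on ℓ^p(ℤ) equals 1. -/
open scoped BigOperators
open MeasureTheory

noncomputable section

open Filter Topology
open scoped ENNReal

theorem hasSum_nat_inv_odd_sq :
    HasSum (fun k : ℕ => 1 / (2 * (k : ℝ) + 1) ^ 2) (Real.pi ^ 2 / 8) := by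
  have hodd : Summable fun k : ℕ => 1 / (2 * (k : ℝ) + 1) ^ 2 := by
    have := hasSum_zeta_two.summable.comp_injective
      (i := fun k : ℕ => 2 * k + 1) (fun a b h => by simpa using h)
    refine this.congr fun k => ?_
    simp
  have heven : HasSum (fun k : ℕ => (1 : ℝ) / ((2 * k : ℕ) : ℝ) ^ 2)
      (1 / 4 * (Real.pi ^ 2 / 6)) := by
    refine (hasSum_zeta_two.mul_left (1 / 4)).congr_fun fun k => ?_
    push_cast
    ring
  have hsum := HasSum.even_add_odd (f := fun n : ℕ => (1 : ℝ) / (n : ℝ) ^ 2) heven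
    (by simpa using hodd.hasSum)
  have heq := hsum.unique hasSum_zeta_two
  have hval : ∑' k : ℕ, 1 / (2 * (k : ℝ) + 1) ^ 2 = Real.pi ^ 2 / 8 := by
    simp only [one_div] at heq ⊢
    linarith
  exact hval ▸ hodd.hasSum

/-- The convolution weights `4 / (π² m²)` of `IT`. -/
def oddWeight (m : {m : ℤ // Odd m}) : ℝ := 4 / Real.pi ^ 2 / ((m : ℤ) : ℝ) ^ 2

theorem oddWeight_nonneg (m : {m : ℤ // Odd m}) : 0 ≤ oddWeight m := by
  unfold oddWeight
  positivity

/-- The bijection `k ↦ 2k + 1` from the integers to the odd integers. -/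
def intEquivOdd : ℤ ≃ {m : ℤ // Odd m} :=
  Equiv.ofBijective (fun k => ⟨2 * k + 1, k, rfl⟩)
    ⟨fun a b h => by simpa using congrArg Subtype.val h,
      fun ⟨_, k, hk⟩ => ⟨k, Subtype.ext hk.symm⟩⟩

theorem coe_intEquivOdd (k : ℤ) : (intEquivOdd k : ℤ) = 2 * k + 1 := rfl

theorem hasSum_oddWeight : HasSum oddWeight 1 := by
  rw [← intEquivOdd.hasSum_iff]
  have hnat := hasSum_nat_inv_odd_sq.mul_left (4 / Real.pi ^ 2)
  have hπ : Real.pi ≠ 0 := Real.pi_ne_zero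
  convert HasSum.of_nat_of_neg_add_one (f := oddWeight ∘ intEquivOdd)
    (hnat.congr_fun fun n => ?_) (hnat.congr_fun fun n => ?_) using 1
  · field_simp
    norm_num
  · simp only [oddWeight, Function.comp_apply, coe_intEquivOdd]
    push_cast
    ring
  · simp only [oddWeight, Function.comp_apply, coe_intEquivOdd]
    push_cast
    rw [show 2 * (-((n : ℝ) + 1)) + 1 = -(2 * n + 1) by ring, neg_sq]
    ring

/-- Jensen's inequality for `x ↦ x ^ p` with respect to a countable probability. -/
theorem ENNReal.rpow_tsum_mul_le_tsum_mul_rpow {ι : Type*} {w : ι → ℝ≥0∞}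
    (hw : ∑' i, w i = 1) (x : ι → ℝ≥0∞) {p : ℝ} (hp : 1 < p) :
    (∑' i, w i * x i) ^ p ≤ ∑' i, w i * x i ^ p := by
  have hpq := Real.HolderConjugate.conjExponent hp
  set q := p.conjExponent
  let _ : MeasurableSpace ι := ⊤
  have h := ENNReal.lintegral_mul_le_Lp_mul_Lq (Measure.count : Measure ι) hpq
    (f := fun i => w i ^ (1 / p) * x i) (g := fun i => w i ^ (1 / q))
    measurable_from_top.aemeasurable measurable_from_top.aemeasurable
  simp only [lintegral_count, Pi.mul_apply] at h
  have hp0 : 0 < p := hpq.pos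
  have hq0 : 0 < q := hpq.symm.pos
  have hmul : ∀ i, w i ^ (1 / p) * x i * w i ^ (1 / q) = w i * x i := fun i => by
    rw [mul_right_comm, ← ENNReal.rpow_add_of_nonneg _ _ (by positivity) (by positivity)]
    simp [hpq.inv_add_inv_eq_one]
  have hf : ∀ i, (w i ^ (1 / p) * x i) ^ p = w i * x i ^ p := fun i => by
    rw [ENNReal.mul_rpow_of_nonneg _ _ hp0.le, ← ENNReal.rpow_mul]
    simp [hp0.ne']
  have hg : ∀ i, (w i ^ (1 / q)) ^ q = w i := fun i => by
    rw [← ENNReal.rpow_mul]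
    simp [hq0.ne']
  simp only [hmul, hf, hg, hw, ENNReal.one_rpow, mul_one] at h
  calc (∑' i, w i * x i) ^ p ≤ ((∑' i, w i * x i ^ p) ^ (1 / p)) ^ p := by gcongr
    _ = ∑' i, w i * x i ^ p := by
      rw [← ENNReal.rpow_mul]
      simp [hp0.ne']

theorem IT_eq_tsum (a : ℤ → ℂ) (n : ℤ) :
    IT a n = ∑' m : {m : ℤ // Odd m}, (oddWeight m : ℂ) * a (n - m) := by
  rw [IT, ← tsum_mul_left]
  refine tsum_congr fun m => ?_
  simp only [oddWeight]
  push_cast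
  ring

theorem tsum_enorm_IT_rpow_le (a : ℤ → ℂ) {p : ℝ} (hp : 1 < p) :
    ∑' n, ‖IT a n‖ₑ ^ p ≤ ∑' n, ‖a n‖ₑ ^ p := by
  have hw : ∑' m, ENNReal.ofReal (oddWeight m) = 1 := by
    rw [← ENNReal.ofReal_tsum_of_nonneg oddWeight_nonneg hasSum_oddWeight.summable,
      hasSum_oddWeight.tsum_eq, ENNReal.ofReal_one]
  have hpt : ∀ n, ‖IT a n‖ₑ ^ p ≤
      ∑' m : {m : ℤ // Odd m}, ENNReal.ofReal (oddWeight m) * ‖a (n - m)‖ₑ ^ p := fun n => by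
    refine le_trans ?_ (ENNReal.rpow_tsum_mul_le_tsum_mul_rpow hw _ hp)
    refine ENNReal.rpow_le_rpow ?_ (by linarith)
    rw [IT_eq_tsum]
    refine enorm_tsum_le_tsum_enorm.trans (ENNReal.tsum_le_tsum fun m => ?_)
    rw [enorm_mul, ← ofReal_norm (oddWeight m : ℂ), Complex.norm_of_nonneg (oddWeight_nonneg m)]
  refine (ENNReal.tsum_le_tsum hpt).trans ?_
  rw [ENNReal.tsum_comm]
  have hshift : ∀ m : ℤ, ∑' n, ‖a (n - m)‖ₑ ^ p = ∑' n, ‖a n‖ₑ ^ p := fun m =>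
    (Equiv.subRight m).tsum_eq fun n => ‖a n‖ₑ ^ p
  simp only [ENNReal.tsum_mul_left, hshift, ENNReal.tsum_mul_right, hw, one_mul, le_refl]

theorem enorm_rpow_eq_ofReal (z : ℂ) {p : ℝ} (hp : 0 ≤ p) :
    ‖z‖ₑ ^ p = ENNReal.ofReal (‖z‖ ^ p) := by
  rw [← ofReal_norm, ENNReal.ofReal_rpow_of_nonneg (norm_nonneg z) hp]

theorem MemLpZ.tsum_enorm_rpow {a : ℤ → ℂ} {p : ℝ} (ha : MemLpZ p a) (hp : 0 ≤ p) :
    ∑' n, ‖a n‖ₑ ^ p = ENNReal.ofReal (∑' n, ‖a n‖ ^ p) := by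
  simp only [enorm_rpow_eq_ofReal _ hp]
  exact (ENNReal.ofReal_tsum_of_nonneg (fun n => by positivity) ha).symm

theorem MemLpZ.IT {a : ℤ → ℂ} {p : ℝ} (ha : MemLpZ p a) (hp : 1 < p) : MemLpZ p (IT a) := by
  have hp0 : 0 ≤ p := by linarith
  have hfin : ∑' n, ENNReal.ofReal (‖_root_.IT a n‖ ^ p) ≠ ∞ := by
    simp only [← enorm_rpow_eq_ofReal _ hp0]
    refine ne_top_of_le_ne_top ?_ (tsum_enorm_IT_rpow_le a hp)
    rw [ha.tsum_enorm_rpow hp0]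
    exact ENNReal.ofReal_ne_top
  refine (ENNReal.summable_toReal hfin).congr fun n => ?_
  rw [ENNReal.toReal_ofReal (by positivity)]

theorem lpNorm_IT_le {a : ℤ → ℂ} {p : ℝ} (ha : MemLpZ p a) (hp : 1 < p) :
    lpNorm p (IT a) ≤ lpNorm p a := by
  have hp0 : 0 ≤ p := by linarith
  have h := tsum_enorm_IT_rpow_le a hp
  rw [ha.tsum_enorm_rpow hp0, (ha.IT hp).tsum_enorm_rpow hp0,
    ENNReal.ofReal_le_ofReal_iff (tsum_nonneg fun n => by positivity)] at h
  exact Real.rpow_le_rpow (tsum_nonneg fun n => by positivity) h (by positivity)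

/-- The two-sided geometric sequence `r ^ |n|`. -/
def geomSeq (r : ℝ) (n : ℤ) : ℂ := (r : ℂ) ^ n.natAbs

theorem norm_geomSeq {r : ℝ} (hr : 0 ≤ r) (n : ℤ) : ‖geomSeq r n‖ = r ^ n.natAbs := by
  rw [geomSeq, norm_pow, Complex.norm_of_nonneg hr]

theorem memLpZ_geomSeq {r p : ℝ} (hr : 0 ≤ r) (hr1 : r < 1) (hp : 0 < p) :
    MemLpZ p (geomSeq r) := by
  have hgeom : Summable fun n : ℕ => (r ^ n) ^ p := by
    refine (summable_geometric_of_lt_one (Real.rpow_nonneg hr p)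
      (Real.rpow_lt_one hr hr1 hp)).congr fun n => ?_
    rw [← Real.rpow_natCast, ← Real.rpow_natCast, ← Real.rpow_mul hr, ← Real.rpow_mul hr, mul_comm]
  refine Summable.of_nat_of_neg ?_ ?_ <;> simpa [norm_geomSeq hr] using hgeom

theorem summable_oddWeight_mul_pow {r : ℝ} (hr : 0 ≤ r) (hr1 : r ≤ 1)
    (e : {m : ℤ // Odd m} → ℕ) : Summable fun m => oddWeight m * r ^ e m :=
  hasSum_oddWeight.summable.of_nonneg_of_le
    (fun m => mul_nonneg (oddWeight_nonneg m) (pow_nonneg hr _))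
    (fun m => mul_le_of_le_one_right (oddWeight_nonneg m) (pow_le_one₀ hr hr1))

theorem mul_norm_geomSeq_le_norm_IT {r : ℝ} (hr : 0 ≤ r) (hr1 : r ≤ 1) (n : ℤ) :
    (∑' m : {m : ℤ // Odd m}, oddWeight m * r ^ (m : ℤ).natAbs) * ‖geomSeq r n‖ ≤
      ‖IT (geomSeq r) n‖ := by
  have hIT : IT (geomSeq r) n =
      ((∑' m : {m : ℤ // Odd m}, oddWeight m * r ^ (n - m : ℤ).natAbs : ℝ) : ℂ) := by
    rw [IT_eq_tsum, Complex.ofReal_tsum]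
    refine tsum_congr fun m => ?_
    simp [geomSeq]
  rw [hIT, norm_geomSeq hr, Complex.norm_of_nonneg
    (tsum_nonneg fun m => mul_nonneg (oddWeight_nonneg m) (pow_nonneg hr _)), ← tsum_mul_right]
  refine Summable.tsum_le_tsum (fun m => ?_)
    ((summable_oddWeight_mul_pow hr hr1 _).mul_right _) (summable_oddWeight_mul_pow hr hr1 _)
  rw [mul_assoc, ← pow_add]
  refine mul_le_mul_of_nonneg_left (pow_le_pow_of_le_one hr hr1 ?_) (oddWeight_nonneg m)
  omega

theorem mul_lpNorm_le_of_forall_mul_norm_le {a b : ℤ → ℂ} {p s : ℝ} (hp : 0 < p) (hs : 0 ≤ s)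
    (hb : MemLpZ p b) (h : ∀ n, s * ‖a n‖ ≤ ‖b n‖) : s * lpNorm p a ≤ lpNorm p b := by
  have hpow : ∀ n, s ^ p * ‖a n‖ ^ p ≤ ‖b n‖ ^ p := fun n => by
    rw [← Real.mul_rpow hs (norm_nonneg _)]
    exact Real.rpow_le_rpow (by positivity) (h n) hp.le
  have hsum : s ^ p * ∑' n, ‖a n‖ ^ p ≤ ∑' n, ‖b n‖ ^ p := by
    rw [← tsum_mul_left]
    exact Summable.tsum_le_tsum hpow (hb.of_nonneg_of_le (fun n => by positivity) hpow) hb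
  have hs' : s = (s ^ p) ^ (1 / p) := by rw [one_div, Real.rpow_rpow_inv hs hp.ne']
  have ha0 : 0 ≤ ∑' n, ‖a n‖ ^ p := tsum_nonneg fun n => by positivity
  calc s * lpNorm p a = (s ^ p * ∑' n, ‖a n‖ ^ p) ^ (1 / p) := by
        rw [Real.mul_rpow (by positivity) ha0, ← hs', _root_.lpNorm]
    _ ≤ lpNorm p b := Real.rpow_le_rpow (by positivity) hsum (by positivity)

theorem lpNorm_geomSeq_pos {r p : ℝ} (hr : 0 ≤ r) (hr1 : r < 1) (hp : 0 < p) :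
    0 < lpNorm p (geomSeq r) := by
  refine Real.rpow_pos_of_pos ?_ _
  refine (memLpZ_geomSeq hr hr1 hp).tsum_pos (fun n => by positivity) 0 ?_
  simp [geomSeq]

theorem tendsto_tsum_oddWeight_mul_pow :
    Tendsto (fun r : ℝ => ∑' m : {m : ℤ // Odd m}, oddWeight m * r ^ (m : ℤ).natAbs)
      (𝓝[<] 1) (𝓝 1) := by
  suffices Tendsto (fun r : ℝ => ∑' m : {m : ℤ // Odd m}, oddWeight m * r ^ (m : ℤ).natAbs)
      (𝓝[<] 1) (𝓝 (∑' m, oddWeight m)) by rwa [hasSum_oddWeight.tsum_eq] at this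
  refine tendsto_tsum_of_dominated_convergence hasSum_oddWeight.summable (fun m => ?_) ?_
  · have hcont : Continuous fun r : ℝ => oddWeight m * r ^ (m : ℤ).natAbs := by fun_prop
    simpa using (hcont.tendsto 1).mono_left nhdsWithin_le_nhds
  · filter_upwards [Ioo_mem_nhdsLT (zero_lt_one' ℝ)] with r hr m
    rw [Real.norm_of_nonneg (mul_nonneg (oddWeight_nonneg m) (pow_nonneg hr.1.le _))]
    exact mul_le_of_le_one_right (oddWeight_nonneg m) (pow_le_one₀ hr.1.le hr.2.le)

theorem one_le_of_forall_lpNorm_IT_le {p C : ℝ} (hp : 1 < p)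
    (hC : ∀ a : ℤ → ℂ, MemLpZ p a → lpNorm p (IT a) ≤ C * lpNorm p a) : 1 ≤ C := by
  have hp0 : 0 < p := by linarith
  refine le_of_tendsto tendsto_tsum_oddWeight_mul_pow ?_
  filter_upwards [Ioo_mem_nhdsLT (zero_lt_one' ℝ)] with r hr
  have ha := memLpZ_geomSeq hr.1.le hr.2 hp0
  refine le_of_mul_le_mul_right ?_ (lpNorm_geomSeq_pos hr.1.le hr.2 hp0)
  exact (mul_lpNorm_le_of_forall_mul_norm_le hp0
    (tsum_nonneg fun m => mul_nonneg (oddWeight_nonneg m) (pow_nonneg hr.1.le _))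
    (ha.IT hp) (mul_norm_geomSeq_le_norm_IT hr.1.le hr.2.le)).trans (hC _ ha)

/-- The operator norm of 𝓘 on ℓ^p(ℤ) equals 1. -/
theorem I_norm_eq_one (p : ℝ) (hp : 1 < p) :
    opNormOn p IT = 1 := by
  refine IsLeast.csInf_eq ⟨⟨zero_le_one, fun a ha => ?_⟩, fun C hC => ?_⟩
  · rw [one_mul]
    exact lpNorm_IT_le ha hp
  · exact one_le_of_forall_lpNorm_IT_le hp hC.2

end
end
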